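/- Let (Ω,𝒜,T,μ,ℱ,‖·‖,χ) fulfill Property 𝔇 with μ(χ>x)=L(x)/x^α for all x>0, L slowly varying, 0<α<1; let (b_n) be natural numbers tending to infinity with b_n=o(n); assume at least one ψ-mixing coefficient of (χ∘T^{n-1}) is strictly less than one; put ζ_n := b_n^{2/3} and g_n := F^←(1−(b_n−ζ_n)/n). Then for every ε>0 there exists N∈ℕ such that for all n≥N one has ∫ S_n^{b_n}χ dμ ≥ (1−ε)·∫ T_n^{g_n}χ dμ. -/

import Mathlib

open MeasureTheory Filter Topology ENNReal

noncomputable section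

/-- Birkhoff sum `S_n χ = ∑_{k=1}^n χ ∘ T^{k-1}`. -/
def birkhoffSumN {Ω : Type*} (T : Ω → Ω) (χ : Ω → ℝ) (n : ℕ) (ω : Ω) : ℝ :=
  ∑ k ∈ Finset.range n, χ (T^[k] ω)

/-- Trimmed sum `S_n^b χ`: the sum of the `n - b` smallest values among
`χ(ω), χ(Tω), …, χ(T^{n-1}ω)`. -/
def trimmedSumN {Ω : Type*} (T : Ω → Ω) (χ : Ω → ℝ) (n b : ℕ) (ω : Ω) : ℝ :=
  (((((List.range n).map fun k => χ (T^[k] ω))).mergeSort (fun a b => a ≤ b)).take (n - b)).sum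

/-- Truncated sum `T_n^f χ = ∑_{k=1}^n (χ·1_{χ ≤ f}) ∘ T^{k-1}`. -/
def truncSumN {Ω : Type*} (T : Ω → Ω) (χ : Ω → ℝ) (n : ℕ) (f : ℝ) (ω : Ω) : ℝ :=
  ∑ k ∈ Finset.range n, if χ (T^[k] ω) ≤ f then χ (T^[k] ω) else 0

/-- A function `L` is slowly varying if `L(cx)/L(x) → 1` as `x → ∞`, for every `c > 0`. -/
def SlowlyVarying (L : ℝ → ℝ) : Prop :=
  ∀ c : ℝ, 0 < c → Tendsto (fun x => L (c * x) / L x) atTop (𝓝 1)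

/-- `ls` is a de Bruijn conjugate of the slowly varying function `Lt`. -/
def IsDeBruijnConjugate (Lt ls : ℝ → ℝ) : Prop :=
  SlowlyVarying ls ∧
  Tendsto (fun x => Lt x * ls (x * Lt x)) atTop (𝓝 1) ∧
  Tendsto (fun x => ls x * Lt (x * ls x)) atTop (𝓝 1)

/-- The measure of dependence `ψ(ℬ,𝒞)` between two sub-σ-fields. -/
def psiDep {Ω : Type*} [MeasurableSpace Ω] (μ : Measure Ω)
    (B C : MeasurableSpace Ω) : ℝ≥0∞ :=
  ⨆ (b : Set Ω) (c : Set Ω) (_ : MeasurableSet[B] b) (_ : MeasurableSet[C] c)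
    (_ : 0 < μ b) (_ : 0 < μ c),
    ENNReal.ofReal |(μ (b ∩ c)).toReal / ((μ b).toReal * (μ c).toReal) - 1|

/-- The σ-field generated by `X_k = χ ∘ T^{k-1}` for `J ≤ k ≤ L`. -/
def sigmaIcc {Ω : Type*} [MeasurableSpace Ω] (T : Ω → Ω) (χ : Ω → ℝ) (J L : ℕ) :
    MeasurableSpace Ω :=
  ⨆ k ∈ Set.Icc J L, MeasurableSpace.comap (fun ω => χ (T^[k - 1] ω)) inferInstance

/-- The σ-field generated by `X_k = χ ∘ T^{k-1}` for `k ≥ J`. -/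
def sigmaIci {Ω : Type*} [MeasurableSpace Ω] (T : Ω → Ω) (χ : Ω → ℝ) (J : ℕ) :
    MeasurableSpace Ω :=
  ⨆ k ∈ Set.Ici J, MeasurableSpace.comap (fun ω => χ (T^[k - 1] ω)) inferInstance

/-- The `n`-th ψ-mixing coefficient of the sequence `(χ ∘ T^{k-1})_{k ≥ 1}`. -/
def psiCoeff {Ω : Type*} [MeasurableSpace Ω] (μ : Measure Ω) (T : Ω → Ω) (χ : Ω → ℝ)
    (n : ℕ) : ℝ≥0∞ :=
  ⨆ (k : ℕ) (_ : 1 ≤ k), psiDep μ (sigmaIcc T χ 1 k) (sigmaIci T χ (k + n))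

/-- A bounded operator `U` has a spectral gap: `U = λ·P + N` with `P` a one-dimensional
projection, `ρ(N) < |λ|`, and `PN = NP = 0`. -/
def HasSpectralGap {F : Type*} [NormedAddCommGroup F] [NormedSpace ℝ F] [CompleteSpace F]
    (U : F →L[ℝ] F) : Prop :=
  ∃ (lam : ℝ) (P N : F →L[ℝ] F),
    U = lam • P + N ∧ P.comp P = P ∧
    Module.finrank ℝ (LinearMap.range (P : F →ₗ[ℝ] F)) = 1 ∧
    spectralRadius ℝ N < ENNReal.ofReal |lam| ∧
    P.comp N = 0 ∧ N.comp P = 0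

/-- Property ℭ: `μ` is a `T`-invariant mixing probability measure, `ℱ` (realized as a Banach
algebra `F` of measurable functions via the injective algebra homomorphism `ι`) contains the
constants, dominates the sup norm, and the transfer operator restricts to a bounded operator
on `F` with a spectral gap. -/
structure PropertyC {Ω : Type*} [MeasurableSpace Ω] (T : Ω → Ω) (μ : Measure Ω)
    {F : Type*} [NormedRing F] [NormedAlgebra ℝ F] [CompleteSpace F]
    (ι : F →ₐ[ℝ] Ω → ℝ) : Prop where
  prob : IsProbabilityMeasure μ
  invariant : MeasurePreserving T μ μ
  mixing : ∀ A B : Set Ω, MeasurableSet A → MeasurableSet B →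
    Tendsto (fun n => μ (A ∩ T^[n] ⁻¹' B)) atTop (𝓝 (μ A * μ B))
  inj : Function.Injective ι
  measurable_mem : ∀ f : F, Measurable (ι f)
  norm_ge_sup : ∀ (f : F) (ω : Ω), |ι f ω| ≤ ‖f‖
  transfer : ∃ That : F →L[ℝ] F,
    (∀ (f : F) (g : Ω → ℝ), Measurable g → (∃ C, ∀ ω, |g ω| ≤ C) →
      ∫ ω, ι (That f) ω * g ω ∂μ = ∫ ω, ι f ω * g (T ω) ∂μ) ∧
    HasSpectralGap That

/-- Property 𝔇: Property ℭ together with the norm control on truncations of the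
nonnegative observable `χ`. -/
structure PropertyD {Ω : Type*} [MeasurableSpace Ω] (T : Ω → Ω) (μ : Measure Ω)
    {F : Type*} [NormedRing F] [NormedAlgebra ℝ F] [CompleteSpace F]
    (ι : F →ₐ[ℝ] Ω → ℝ) (χ : Ω → ℝ) extends PropertyC T μ ι : Prop where
  chi_nonneg : ∀ ω, 0 ≤ χ ω
  chi_meas : Measurable χ
  norm_bound : ∃ K₁ > (0 : ℝ), ∀ ℓ : ℝ, 0 ≤ ℓ →
    (∃ f : F, ι f = (fun ω => if χ ω ≤ ℓ then χ ω else 0) ∧ ‖f‖ ≤ K₁ * ℓ) ∧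
    (∃ g : F, ι g = (fun ω => if ℓ < χ ω then (1 : ℝ) else 0) ∧ ‖g‖ ≤ K₁)

/-- The distribution function `F(x) = μ(χ ≤ x)`. -/
def distF {Ω : Type*} [MeasurableSpace Ω] (μ : Measure Ω) (χ : Ω → ℝ) (x : ℝ) : ℝ :=
  (μ {ω | χ ω ≤ x}).toReal

/-- Generalized inverse `F^←(y) = inf {x | F(x) ≥ y}`. -/
def genInv (F : ℝ → ℝ) (y : ℝ) : ℝ := sInf {x : ℝ | y ≤ F x}

/-- `g_n = F^←(1 - (b_n - ζ_n)/n)` where `ζ_n = b_n^{2/3}`. -/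
def gSeq {Ω : Type*} [MeasurableSpace Ω] (μ : Measure Ω) (χ : Ω → ℝ) (b : ℕ → ℕ)
    (n : ℕ) : ℝ :=
  genInv (distF μ χ) (1 - ((b n : ℝ) - (b n : ℝ) ^ ((2 : ℝ) / 3)) / n)

/-- The norming sequence `d_n = (α/(1-α))·n^{1/α}·b_n^{1-1/α}·ℓ^#((n/b_n)^{1/α})`. -/
def dSeq (α : ℝ) (ls : ℝ → ℝ) (b : ℕ → ℕ) (n : ℕ) : ℝ :=
  α / (1 - α) * (n : ℝ) ^ (1 / α) * (b n : ℝ) ^ (1 - 1 / α) *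
    ls (((n : ℝ) / (b n : ℝ)) ^ (1 / α))

end

namespace TrimAux

lemma take_sum_le_sublist : ∀ (l t : List ℝ), l.Pairwise (fun a b => a ≤ b) → t.Sublist l →
    (l.take t.length).sum ≤ t.sum
  | [], t, _, h => by
      have : t = [] := by simpa using h
      subst this; simp
  | a :: l, t, hl, h => by
      rw [List.pairwise_cons] at hl
      cases t with
      | nil => simp
      | cons c t' =>
        simp only [List.length_cons, List.take_succ_cons, List.sum_cons]
        have h1 : t'.Sublist l := List.Sublist.tail h
        have h2 := take_sum_le_sublist l t' hl.2 h1
        have h3 : a ≤ c := by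
          have : c ∈ a :: l := h.subset (by simp)
          rcases List.mem_cons.1 this with h | h
          · exact h.ge
          · exact hl.1 c h
        linarith

variable {Ω : Type*} [MeasurableSpace Ω] (T : Ω → Ω) (χ : Ω → ℝ)

lemma trimmed_le (n b : ℕ) (ω : Ω) (l' : List ℕ) (hl : l'.Sublist (List.range n))
    (hlen : l'.length = n - b) :
    trimmedSumN T χ n b ω ≤ (l'.map fun k => χ (T^[k] ω)).sum := by
  unfold trimmedSumN
  set m := (List.range n).map fun k => χ (T^[k] ω) with hm
  have hp : (m.mergeSort (fun a b => a ≤ b)).Perm m := List.mergeSort_perm _ _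
  have hs : (m.mergeSort (fun a b => decide (a ≤ b))).Pairwise (fun a b => a ≤ b) := by
    have := List.pairwise_mergeSort (le := fun a b : ℝ => decide (a ≤ b))
      (by intro a b c; simpa using le_trans) (by intro a b; simpa using le_total a b) m
    simpa using this
  have h1 : (l'.map fun k => χ (T^[k] ω)).Subperm (m.mergeSort (fun a b => a ≤ b)) :=
    (hl.map _).subperm.trans hp.symm.subperm
  obtain ⟨t, ht, hts⟩ := h1
  have := take_sum_le_sublist _ t hs hts
  rw [ht.sum_eq, ht.length_eq, List.length_map, hlen] at this
  exact this

lemma exists_trimmed (n b : ℕ) (ω : Ω) : ∃ l' : List ℕ, l'.Sublist (List.range n) ∧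
    l'.length = n - b ∧ trimmedSumN T χ n b ω = (l'.map fun k => χ (T^[k] ω)).sum := by
  unfold trimmedSumN
  set m := (List.range n).map fun k => χ (T^[k] ω) with hm
  have hp : (m.mergeSort (fun a b => a ≤ b)).Perm m := List.mergeSort_perm _ _
  have h1 : ((m.mergeSort (fun a b => a ≤ b)).take (n - b)).Subperm m :=
    (List.take_sublist _ _).subperm.trans hp.subperm
  obtain ⟨t, ht, hts⟩ := h1
  obtain ⟨l', hl', rfl⟩ := List.sublist_map_iff.1 hts
  refine ⟨l', hl', ?_, ht.sum_eq.symm⟩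
  have := ht.length_eq
  rw [List.length_map, List.length_take, hp.length_eq] at this
  rw [this, hm]; simp

lemma trimmed_nonneg (h0 : ∀ ω, 0 ≤ χ ω) (n b : ℕ) (ω : Ω) : 0 ≤ trimmedSumN T χ n b ω := by
  obtain ⟨l, -, -, h⟩ := exists_trimmed T χ n b ω
  rw [h]
  apply List.sum_nonneg
  intro x hx
  obtain ⟨k, -, rfl⟩ := List.mem_map.1 hx
  exact h0 _

lemma trimmed_measurable (hT : Measurable T) (hχ : Measurable χ) (n b : ℕ) :
    Measurable (trimmedSumN T χ n b) := by
  apply measurable_of_Iic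
  intro a
  have : trimmedSumN T χ n b ⁻¹' Set.Iic a =
      ⋃ l ∈ {l | l ∈ (List.range n).sublistsLen (n - b)},
        {ω | (l.map fun k => χ (T^[k] ω)).sum ≤ a} := by
    ext ω
    simp only [Set.mem_preimage, Set.mem_Iic, Set.mem_iUnion, Set.mem_ofPred_eq,
      List.mem_sublistsLen, exists_prop]
    constructor
    · intro h
      obtain ⟨l, h1, h2, h3⟩ := exists_trimmed T χ n b ω
      exact ⟨l, ⟨h1, h2⟩, h3 ▸ h⟩
    · rintro ⟨l, ⟨h1, h2⟩, h3⟩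
      exact (trimmed_le T χ n b ω l h1 h2).trans h3
  rw [this]
  refine Set.Finite.measurableSet_biUnion (List.finite_toSet _) ?_
  intro l hl
  apply measurableSet_le _ measurable_const
  clear hl this
  induction l with
  | nil => simp
  | cons k l ih =>
    simp only [List.map_cons, List.sum_cons]
    exact (hχ.comp (hT.iterate k)).add ih

lemma trimmed_le_of_card (h0 : ∀ ω, 0 ≤ χ ω) (n b : ℕ) (ω : Ω) (x : ℝ) (hx : 0 ≤ x)
    (hc : ((Finset.range n).filter fun k => x < χ (T^[k] ω)).card ≤ b) :
    trimmedSumN T χ n b ω ≤ n * x := by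
  classical
  set l := (List.range n).filter (fun k => χ (T^[k] ω) ≤ x) with hl
  have hlen : n - b ≤ l.length := by
    have h1 : l.length = ((Finset.range n).filter fun k => ¬ (x < χ (T^[k] ω))).card := by
      rw [← List.toFinset_card_of_nodup (List.nodup_range.filter _)]
      congr 1
      ext k; simp [hl]
    have h2 := Finset.card_filter_add_card_filter_not (s := Finset.range n)
      (fun k => x < χ (T^[k] ω))
    rw [Finset.card_range] at h2
    omega
  have hs : (l.take (n - b)).Sublist (List.range n) :=
    (List.take_sublist _ _).trans List.filter_sublist
  refine (trimmed_le T χ n b ω _ hs (by rw [List.length_take]; omega)).trans ?_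
  refine (List.sum_le_card_nsmul _ x ?_).trans ?_
  · intro y hy
    obtain ⟨k, hk, rfl⟩ := List.mem_map.1 hy
    have := List.mem_of_mem_take hk
    simpa using (List.mem_filter.1 this).2
  · rw [nsmul_eq_mul, List.length_map, List.length_take]
    gcongr
    omega

lemma trimmed_ge (n b : ℕ) (ω : Ω) (g : ℝ) (hg : 0 ≤ g) :
    ∑ k ∈ Finset.range n, min (χ (T^[k] ω)) g - b * g ≤ trimmedSumN T χ n b ω := by
  unfold trimmedSumN
  set m := (List.range n).map fun k => χ (T^[k] ω) with hm
  have hp : (m.mergeSort (fun a b => a ≤ b)).Perm m := List.mergeSort_perm _ _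
  set s := m.mergeSort (fun a b => a ≤ b)
  have h1 : ∑ k ∈ Finset.range n, min (χ (T^[k] ω)) g = (s.map fun y => min y g).sum := by
    rw [(hp.map _).sum_eq, hm, List.map_map]
    simp [Finset.sum, Finset.range, Function.comp_def]
    rfl
  have h2 : (s.map fun y => min y g).sum
      = ((s.take (n-b)).map fun y => min y g).sum + ((s.drop (n-b)).map fun y => min y g).sum := by
    rw [← List.sum_append, ← List.map_append, List.take_append_drop]
  have h3 : ((s.take (n-b)).map fun y => min y g).sum ≤ (s.take (n-b)).sum := by
    have := List.sum_le_sum (l := s.take (n-b)) (f := fun y => min y g) (g := fun y => y)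
      (fun i _ => min_le_left _ _)
    simpa using this
  have h4 : ((s.drop (n-b)).map fun y => min y g).sum ≤ b * g := by
    refine (List.sum_le_card_nsmul _ g ?_).trans ?_
    · intro y hy
      obtain ⟨k, hk, rfl⟩ := List.mem_map.1 hy
      exact min_le_right _ _
    · rw [nsmul_eq_mul, List.length_map, List.length_drop]
      gcongr
      rw [hp.length_eq, hm]; simp; omega
  linarith

lemma psi_le (μ : Measure Ω) [IsProbabilityMeasure μ] (r : ℕ) (h : psiCoeff μ T χ r < 1) (k : ℕ)
    (hk : 1 ≤ k) (B C : Set Ω) (hB : MeasurableSet[sigmaIcc T χ 1 k] B)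
    (hC : MeasurableSet[sigmaIci T χ (k + r)] C) :
    μ.real (B ∩ C) ≤ 2 * (μ.real B * μ.real C) := by
  by_cases hB0 : μ B = 0
  · have : μ (B ∩ C) = 0 := measure_mono_null Set.inter_subset_left hB0
    simp [Measure.real, this, hB0]
  by_cases hC0 : μ C = 0
  · have : μ (B ∩ C) = 0 := measure_mono_null Set.inter_subset_right hC0
    simp [Measure.real, this, hC0]
  have h1 : ENNReal.ofReal |(μ (B ∩ C)).toReal / ((μ B).toReal * (μ C).toReal) - 1| ≤
      psiCoeff μ T χ r := by
    unfold psiCoeff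
    refine le_trans ?_ (le_iSup₂ (f := fun (k : ℕ) (_ : 1 ≤ k) =>
      psiDep μ (sigmaIcc T χ 1 k) (sigmaIci T χ (k + r))) k hk)
    unfold psiDep
    refine le_iSup_of_le B (le_iSup_of_le C (le_iSup_of_le hB (le_iSup_of_le hC
      (le_iSup_of_le (pos_iff_ne_zero.2 hB0) (le_iSup_of_le (pos_iff_ne_zero.2 hC0) le_rfl)))))
  have h2 := h1.trans_lt h
  rw [ENNReal.ofReal_lt_one, abs_lt] at h2
  have hpos : 0 < (μ B).toReal * (μ C).toReal :=
    mul_pos (ENNReal.toReal_pos hB0 (measure_ne_top _ _))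
      (ENNReal.toReal_pos hC0 (measure_ne_top _ _))
  have h3 : (μ (B ∩ C)).toReal / ((μ B).toReal * (μ C).toReal) ≤ 2 := by linarith [h2.2]
  rw [div_le_iff₀ hpos] at h3
  exact h3

lemma meas_exceed (J k : ℕ) (x : ℝ) (S : MeasurableSpace Ω)
    (h : MeasurableSpace.comap (fun ω => χ (T^[k] ω)) inferInstance ≤ S) :
    MeasurableSet[S] {ω | x < χ (T^[k] ω)} := by
  apply h
  exact ⟨Set.Ioi x, measurableSet_Ioi, rfl⟩

lemma inter_le (μ : Measure Ω) [IsProbabilityMeasure μ] (hT : MeasurePreserving T μ μ)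
    (hχ : Measurable χ) (r : ℕ) (hr : 1 ≤ r) (h : psiCoeff μ T χ r < 1) (x : ℝ) (j : ℕ) :
    ∀ s : Finset ℕ, r * j ≤ s.card →
      μ.real {ω | ∀ k ∈ s, x < χ (T^[k] ω)} ≤ (2 * μ.real {ω | x < χ ω}) ^ j := by
  have hinv : ∀ k, μ.real {ω | x < χ (T^[k] ω)} = μ.real {ω | x < χ ω} := by
    intro k
    have := (hT.iterate k).measureReal_preimage
      (measurableSet_lt measurable_const hχ : MeasurableSet {ω | x < χ ω}).nullMeasurableSet
    exact this
  induction j with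
  | zero => intro s _; simpa using measureReal_le_one
  | succ j ih =>
    intro s hs
    have hne : s.Nonempty := by
      rw [← Finset.card_pos]; nlinarith
    set M := s.max' hne with hM
    set s' := s.filter (fun k => k + r ≤ M) with hs'
    have hcard : r * j ≤ s'.card := by
      have h1 := Finset.card_filter_add_card_filter_not (s := s) (fun k => k + r ≤ M)
      have h2 : (s.filter (fun k => ¬ (k + r ≤ M))).card ≤ (Finset.Ioc (M - r) M ∪
          (Finset.range (M+1)).filter (fun k => M < k + r)).card := by
        apply Finset.card_le_card
        intro k hk
        have := s.le_max' k (Finset.mem_filter.1 hk).1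
        simp only [Finset.mem_filter, Finset.mem_union, Finset.mem_Ioc, Finset.mem_range] at hk ⊢
        right; omega
      have h3 : (Finset.Ioc (M - r) M ∪
          (Finset.range (M+1)).filter (fun k => M < k + r)).card ≤ r := by
        have : (Finset.Ioc (M - r) M ∪
          (Finset.range (M+1)).filter (fun k => M < k + r)) ⊆ Finset.Ico (M + 1 - r) (M + 1) := by
          intro k hk
          simp only [Finset.mem_filter, Finset.mem_union, Finset.mem_Ioc, Finset.mem_range,
            Finset.mem_Ico] at hk ⊢
          omega
        refine (Finset.card_le_card this).trans ?_
        simp; omega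
      have h4 : r * (j + 1) = r * j + r := by ring
      rw [hs']
      omega
    have hp0 : 0 ≤ μ.real {ω | x < χ ω} := measureReal_nonneg
    have hMs : M ∈ s := s.max'_mem hne
    by_cases hs0 : s' = ∅
    · have hj : j = 0 := by
        rw [hs0] at hcard
        simp at hcard; omega
      subst hj
      calc μ.real {ω | ∀ k ∈ s, x < χ (T^[k] ω)} ≤ μ.real {ω | x < χ (T^[M] ω)} :=
            measureReal_mono (fun ω hω => hω M hMs)
        _ = μ.real {ω | x < χ ω} := hinv M
        _ ≤ _ := by simp; linarith
    · obtain ⟨k0, hk0⟩ := Finset.nonempty_iff_ne_empty.2 hs0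
      have hrM : r ≤ M := by
        have := (Finset.mem_filter.1 hk0).2
        omega
      have key := psi_le T χ μ r h (M + 1 - r) (by omega) {ω | ∀ k ∈ s', x < χ (T^[k] ω)}
        {ω | x < χ (T^[M] ω)} (by
          have : {ω | ∀ k ∈ s', x < χ (T^[k] ω)} = ⋂ k ∈ s', {ω | x < χ (T^[k] ω)} := by
            ext; simp
          rw [this]
          refine Finset.measurableSet_biInter _ ?_
          intro k hk
          have hkM := (Finset.mem_filter.1 hk).2
          apply meas_exceed T χ 0
          unfold sigmaIcc
          exact le_iSup₂_of_le (k + 1) ⟨by omega, by omega⟩ le_rfl) (by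
          apply meas_exceed T χ 0
          unfold sigmaIci
          exact le_iSup₂_of_le (M + 1) (by simp; omega) le_rfl)
      calc μ.real {ω | ∀ k ∈ s, x < χ (T^[k] ω)}
          ≤ μ.real ({ω | ∀ k ∈ s', x < χ (T^[k] ω)} ∩ {ω | x < χ (T^[M] ω)}) :=
            measureReal_mono (fun ω hω => ⟨fun k hk => hω k (Finset.mem_filter.1 hk).1, hω M hMs⟩)
        _ ≤ _ := key
        _ = 2 * (μ.real {ω | ∀ k ∈ s', x < χ (T^[k] ω)} * μ.real {ω | x < χ ω}) := by rw [hinv M]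
        _ ≤ 2 * ((2 * μ.real {ω | x < χ ω}) ^ j * μ.real {ω | x < χ ω}) := by
            gcongr
            exact ih s' hcard
        _ = _ := by ring

lemma count_le (μ : Measure Ω) [IsProbabilityMeasure μ] (hT : MeasurePreserving T μ μ)
    (hχ : Measurable χ) (h0 : ∀ ω, 0 ≤ χ ω)
    (r : ℕ) (hr : 1 ≤ r) (h : psiCoeff μ T χ r < 1) (x : ℝ) (hx : 0 ≤ x) (j n b : ℕ)
    (hb : r * j ≤ b) :
    μ.real {ω | n * x < trimmedSumN T χ n b ω} ≤ 2 ^ n * (2 * μ.real {ω | x < χ ω}) ^ j := by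
  classical
  have hsub : {ω | n * x < trimmedSumN T χ n b ω} ⊆
      ⋃ s ∈ (Finset.range n).powerset.filter (fun s => r * j ≤ s.card),
        {ω | ∀ k ∈ s, x < χ (T^[k] ω)} := by
    intro ω hω
    have : ¬ ((Finset.range n).filter fun k => x < χ (T^[k] ω)).card ≤ b := fun hc =>
      absurd (trimmed_le_of_card T χ h0 n b ω x hx hc) (not_le.2 hω)
    simp only [Set.mem_iUnion, exists_prop]
    refine ⟨(Finset.range n).filter fun k => x < χ (T^[k] ω), ?_, ?_⟩
    · simp only [Finset.mem_filter, Finset.mem_powerset]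
      exact ⟨Finset.filter_subset _ _, by omega⟩
    · intro k hk; exact (Finset.mem_filter.1 hk).2
  refine (measureReal_mono hsub (measure_ne_top _ _)).trans ?_
  refine (measureReal_biUnion_finset_le _ _).trans ?_
  refine (Finset.sum_le_card_nsmul _ _ _ (fun s hs =>
    inter_le T χ μ hT hχ r hr h x j s (Finset.mem_filter.1 hs).2)).trans ?_
  rw [nsmul_eq_mul]
  gcongr
  · have := Finset.card_filter_le (Finset.range n).powerset (fun s => r * j ≤ s.card)
    rw [Finset.card_powerset, Finset.card_range] at this
    exact_mod_cast this

lemma trimmed_integrable (μ : Measure Ω) [IsProbabilityMeasure μ] (hT : MeasurePreserving T μ μ)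
    (hχ : Measurable χ) (h0 : ∀ ω, 0 ≤ χ ω)
    (r : ℕ) (hr : 1 ≤ r) (h : psiCoeff μ T χ r < 1) (x₀ ρ : ℝ) (hx : 0 < x₀) (hρ : 0 ≤ ρ)
    (hρx : ∀ x, x₀ ≤ x → μ.real {ω | 2 * x < χ ω} ≤ ρ * μ.real {ω | x < χ ω})
    (j n b : ℕ) (hj : ρ ^ j < 1 / 2) (hb : r * j ≤ b) (hn : 1 ≤ n) :
    Integrable (trimmedSumN T χ n b) μ := by
  have hmeas := trimmed_measurable T χ hT.measurable hχ n b
  have hnn := trimmed_nonneg T χ h0 n b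
  have hn0 : (0 : ℝ) < n := by exact_mod_cast hn
  have hp : ∀ k : ℕ, μ.real {ω | 2 ^ k * x₀ < χ ω} ≤ ρ ^ k := by
    intro k
    induction k with
    | zero => simpa using measureReal_le_one
    | succ k ih =>
      have := hρx (2 ^ k * x₀) (le_mul_of_one_le_left hx.le (one_le_pow₀ (by norm_num)))
      calc μ.real {ω | 2 ^ (k+1) * x₀ < χ ω} = μ.real {ω | 2 * (2 ^ k * x₀) < χ ω} := by
            congr 2; ext ω; rw [pow_succ]; ring_nf
        _ ≤ _ := this
        _ ≤ ρ * ρ ^ k := by gcongr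
        _ = _ := by ring
  refine ⟨hmeas.aestronglyMeasurable, ?_⟩
  rw [hasFiniteIntegral_iff_ofReal (ae_of_all _ hnn)]
  set E : ℕ → Set Ω := fun k => {ω | n * (2 ^ k * x₀) < trimmedSumN T χ n b ω} with hE
  have hEm : ∀ k, MeasurableSet (E k) := fun k => measurableSet_lt measurable_const hmeas
  have hpt : ∀ ω, ENNReal.ofReal (trimmedSumN T χ n b ω) ≤ ENNReal.ofReal (n * x₀) +
      ∑' k, (E k).indicator (fun _ => ENNReal.ofReal (n * (2 ^ (k + 1) * x₀))) ω := by
    intro ω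
    by_cases h1 : trimmedSumN T χ n b ω ≤ n * x₀
    · exact (ENNReal.ofReal_le_ofReal h1).trans le_self_add
    · have hex : ∃ k : ℕ, trimmedSumN T χ n b ω ≤ n * (2 ^ k * x₀) := by
        obtain ⟨k, hk⟩ := pow_unbounded_of_one_lt (trimmedSumN T χ n b ω / (n * x₀))
          (one_lt_two)
        refine ⟨k, ?_⟩
        rw [div_lt_iff₀ (by positivity)] at hk
        linarith
      classical
      obtain ⟨k, hk⟩ : ∃ k, Nat.find hex = k + 1 := by
        apply Nat.exists_eq_succ_of_ne_zero
        intro hz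
        have := Nat.find_spec hex
        rw [hz] at this
        simp at this
        exact h1 this
      have hs := Nat.find_spec hex
      rw [hk] at hs
      have hm := Nat.find_min hex (m := k) (by omega)
      have hmem : ω ∈ E k := not_le.1 hm
      refine le_trans ?_ (le_trans (ENNReal.le_tsum k) le_add_self)
      rw [Set.indicator_of_mem hmem]
      exact ENNReal.ofReal_le_ofReal hs
  refine (lintegral_mono hpt).trans_lt ?_
  rw [lintegral_add_left measurable_const, lintegral_tsum
    (fun k => (measurable_const.indicator (hEm k)).aemeasurable)]
  refine ENNReal.add_lt_top.2 ⟨by rw [lintegral_const]; simp [ENNReal.mul_lt_top], ?_⟩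
  have hbd : ∀ k, ∫⁻ ω, (E k).indicator (fun _ => ENNReal.ofReal (n * (2 ^ (k + 1) * x₀))) ω ∂μ ≤
      ENNReal.ofReal ((n * 2 * x₀ * 2 ^ n * 2 ^ j) * (2 * ρ ^ j) ^ k) := by
    intro k
    rw [lintegral_indicator_const (hEm k), ← ofReal_measureReal,
      ← ENNReal.ofReal_mul (by positivity)]
    apply ENNReal.ofReal_le_ofReal
    have h1 := count_le T χ μ hT hχ h0 r hr h (2 ^ k * x₀) (by positivity) j n b hb
    have h2 : μ.real (E k) ≤ 2 ^ n * (2 * ρ ^ k) ^ j := by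
      refine h1.trans ?_
      have := hp k
      gcongr
    calc n * (2 ^ (k + 1) * x₀) * μ.real (E k)
        ≤ n * (2 ^ (k + 1) * x₀) * (2 ^ n * (2 * ρ ^ k) ^ j) := by gcongr
      _ = _ := by rw [mul_pow, mul_pow, pow_succ, ← pow_mul, ← pow_mul, mul_comm k j]; ring
  refine (ENNReal.tsum_le_tsum hbd).trans_lt ?_
  have hsum : Summable fun k : ℕ => (n * 2 * x₀ * 2 ^ n * 2 ^ j) * (2 * ρ ^ j) ^ k :=
    (summable_geometric_of_lt_one (by positivity) (by linarith)).mul_left _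
  exact hsum.tsum_ofReal_lt_top


lemma ratio_tendsto (p L : ℝ → ℝ) (hL : SlowlyVarying L) (α : ℝ)
    (htail : ∀ x : ℝ, 0 < x → p x = L x / x ^ α) (c : ℝ) (hc : 0 < c) :
    Tendsto (fun x => p (c * x) / p x) atTop (𝓝 (c ^ (-α))) := by
  have h1 := (hL c hc).mul_const (c ^ (-α))
  rw [one_mul] at h1
  refine h1.congr' ?_
  filter_upwards [eventually_gt_atTop 0] with x hx
  rw [htail x hx, htail (c * x) (mul_pos hc hx), Real.mul_rpow hc.le hx.le, Real.rpow_neg hc.le]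
  have h2 : c ^ α ≠ 0 := (Real.rpow_pos_of_pos hc α).ne'
  have h3 : x ^ α ≠ 0 := (Real.rpow_pos_of_pos hx α).ne'
  field_simp

lemma ratio_le (p L : ℝ → ℝ) (hL : SlowlyVarying L) (α : ℝ)
    (htail : ∀ x : ℝ, 0 < x → p x = L x / x ^ α) (hp : ∀ x, 0 < x → 0 < p x) (c : ℝ) (hc : 0 < c)
    (q : ℝ) (hq : c ^ (-α) < q) : ∀ᶠ x in atTop, p (c * x) ≤ q * p x := by
  filter_upwards [(ratio_tendsto p L hL α htail c hc).eventually (gt_mem_nhds hq),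
    eventually_gt_atTop 0] with x h1 hx
  rw [div_lt_iff₀ (hp x hx)] at h1
  exact h1.le

lemma ratio_ge (p L : ℝ → ℝ) (hL : SlowlyVarying L) (α : ℝ)
    (htail : ∀ x : ℝ, 0 < x → p x = L x / x ^ α) (hp : ∀ x, 0 < x → 0 < p x) (c : ℝ) (hc : 0 < c)
    (q : ℝ) (hq : q < c ^ (-α)) : ∀ᶠ x in atTop, q * p x ≤ p (c * x) := by
  filter_upwards [(ratio_tendsto p L hL α htail c hc).eventually (lt_mem_nhds hq),
    eventually_gt_atTop 0] with x h1 hx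
  rw [lt_div_iff₀ (hp x hx)] at h1
  exact h1.le

lemma trunc_lower (μ : Measure Ω) [IsProbabilityMeasure μ] (hχ : Measurable χ)
    (h0 : ∀ ω, 0 ≤ χ ω) (g : ℝ) (hg : 0 ≤ g) :
    g / 2 * (μ.real {ω | g / 2 < χ ω} - μ.real {ω | g < χ ω}) ≤
      ∫ ω, (if χ ω ≤ g then χ ω else 0) ∂μ := by
  have hm1 : MeasurableSet {ω | g / 2 < χ ω} := measurableSet_lt measurable_const hχ
  have hm2 : MeasurableSet {ω | g < χ ω} := measurableSet_lt measurable_const hχ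
  have hsub : {ω | g < χ ω} ⊆ {ω | g / 2 < χ ω} := by
    intro ω (hω : g < χ ω)
    show g / 2 < χ ω
    linarith
  rw [← measureReal_diff hsub hm2, mul_comm, ← smul_eq_mul,
    ← integral_indicator_const (g / 2) (hm1.diff hm2)]
  apply integral_mono
  · exact (integrable_const _).indicator (hm1.diff hm2)
  · refine Integrable.of_bound (C := g) (Measurable.aestronglyMeasurable
      (Measurable.ite (measurableSet_le hχ measurable_const) hχ measurable_const))
      (ae_of_all _ fun ω => ?_)
    split_ifs with h
    · rw [Real.norm_of_nonneg (h0 ω)]; exact h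
    · simpa using hg
  · intro ω
    show Set.indicator _ _ ω ≤ _
    by_cases h : ω ∈ {ω | g / 2 < χ ω} \ {ω | g < χ ω}
    · rw [Set.indicator_of_mem h]
      have h1 : g / 2 < χ ω := h.1
      have h2 : χ ω ≤ g := not_lt.1 h.2
      show g / 2 ≤ if χ ω ≤ g then χ ω else 0
      rw [if_pos h2]; exact h1.le
    · rw [Set.indicator_of_notMem h]
      show 0 ≤ if χ ω ≤ g then χ ω else 0
      split_ifs
      · exact h0 ω
      · exact le_rfl

lemma integral_sum_comp (μ : Measure Ω) [IsProbabilityMeasure μ] (hT : MeasurePreserving T μ μ)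
    (f : Ω → ℝ) (hf : Measurable f) (hi : Integrable f μ) (n : ℕ) :
    Integrable (fun ω => ∑ k ∈ Finset.range n, f (T^[k] ω)) μ ∧
    ∫ ω, ∑ k ∈ Finset.range n, f (T^[k] ω) ∂μ = n * ∫ ω, f ω ∂μ := by
  have h1 : ∀ k, Integrable (fun ω => f (T^[k] ω)) μ := fun k =>
    (hT.iterate k).integrable_comp_of_integrable hi
  have h2 : ∀ k, ∫ ω, f (T^[k] ω) ∂μ = ∫ ω, f ω ∂μ := by
    intro k
    have hk := hT.iterate k
    conv_rhs => rw [← hk.map_eq]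
    rw [integral_map hk.measurable.aemeasurable hf.aestronglyMeasurable]
  refine ⟨integrable_finset_sum _ fun k _ => h1 k, ?_⟩
  rw [integral_finset_sum _ fun k _ => h1 k]
  simp [h2]

lemma expect_lower (μ : Measure Ω) [IsProbabilityMeasure μ] (hT : MeasurePreserving T μ μ)
    (hχ : Measurable χ) (h0 : ∀ ω, 0 ≤ χ ω) (n b : ℕ) (g : ℝ) (hg : 0 ≤ g)
    (hS : Integrable (trimmedSumN T χ n b) μ) :
    ∫ ω, truncSumN T χ n g ω ∂μ = n * ∫ ω, (if χ ω ≤ g then χ ω else 0) ∂μ ∧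
    n * ∫ ω, (if χ ω ≤ g then χ ω else 0) ∂μ + n * (g * μ.real {ω | g < χ ω}) - b * g ≤
      ∫ ω, trimmedSumN T χ n b ω ∂μ := by
  have hm2 : MeasurableSet {ω | g < χ ω} := measurableSet_lt measurable_const hχ
  have hfm : Measurable (fun ω => if χ ω ≤ g then χ ω else 0) :=
    Measurable.ite (measurableSet_le hχ measurable_const) hχ measurable_const
  have hfi : Integrable (fun ω => if χ ω ≤ g then χ ω else 0) μ := by
    refine Integrable.of_bound (C := g) hfm.aestronglyMeasurable (ae_of_all _ fun ω => ?_)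
    split_ifs with h
    · rw [Real.norm_of_nonneg (h0 ω)]; exact h
    · simpa using hg
  have h1 := integral_sum_comp T μ hT _ hfm hfi n
  refine ⟨h1.2, ?_⟩
  have hii : Integrable ({ω | g < χ ω}.indicator (fun _ => g)) μ :=
    (integrable_const _).indicator hm2
  have heq : (fun ω => min (χ ω) g) =
      fun ω => (if χ ω ≤ g then χ ω else 0) + {ω | g < χ ω}.indicator (fun _ => g) ω := by
    funext ω
    by_cases h : χ ω ≤ g
    · have : ω ∉ {ω | g < χ ω} := not_lt.2 h
      rw [Set.indicator_of_notMem this, if_pos h, min_eq_left h, add_zero]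
    · have : ω ∈ {ω | g < χ ω} := not_le.1 h
      rw [Set.indicator_of_mem this, if_neg h, min_eq_right (not_le.1 h).le, zero_add]
  have hmi : Integrable (fun ω => min (χ ω) g) μ := by
    rw [heq]; exact hfi.add hii
  have hint : ∫ ω, min (χ ω) g ∂μ =
      ∫ ω, (if χ ω ≤ g then χ ω else 0) ∂μ + g * μ.real {ω | g < χ ω} := by
    rw [heq, integral_add hfi hii, integral_indicator_const _ hm2, smul_eq_mul, mul_comm g]
  have h2 := integral_sum_comp T μ hT _ (hχ.min measurable_const) hmi n
  have h3 : ∫ ω, (∑ k ∈ Finset.range n, min (χ (T^[k] ω)) g - (b : ℝ) * g) ∂μ ≤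
      ∫ ω, trimmedSumN T χ n b ω ∂μ :=
    integral_mono (h2.1.sub (integrable_const ((b : ℝ) * g))) hS
      (fun ω => trimmed_ge T χ n b ω g hg)
  have h4 : ∫ ω, (∑ k ∈ Finset.range n, min (χ (T^[k] ω)) g - (b : ℝ) * g) ∂μ
      = n * ∫ ω, min (χ ω) g ∂μ - b * g := by
    rw [← h2.2, integral_sub h2.1 (integrable_const _)]
    simp
  rw [h4, hint] at h3
  linarith

end TrimAux

theorem trimmed_sum_lower_bound_by_truncated
    {Ω : Type*} [MeasurableSpace Ω] (T : Ω → Ω) (μ : Measure Ω)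
    {F : Type*} [NormedRing F] [NormedAlgebra ℝ F] [CompleteSpace F]
    (ι : F →ₐ[ℝ] Ω → ℝ) (χ : Ω → ℝ)
    (hD : PropertyD T μ ι χ)
    (L : ℝ → ℝ) (hL : SlowlyVarying L) (hLpos : ∀ x : ℝ, 0 < x → 0 < L x)
    {α : ℝ} (hα0 : 0 < α) (hα1 : α < 1)
    (htail : ∀ x : ℝ, 0 < x → (μ {ω | x < χ ω}).toReal = L x / x ^ α)
    (b : ℕ → ℕ) (hb : Tendsto b atTop atTop)
    (hbo : Tendsto (fun n => (b n : ℝ) / (n : ℝ)) atTop (𝓝 0))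
    (hmix : ∃ r : ℕ, 1 ≤ r ∧ psiCoeff μ T χ r < 1)
    :
    ∀ ε : ℝ, 0 < ε → ∃ N : ℕ, ∀ n ≥ N,
      ∫ ω, trimmedSumN T χ n (b n) ω ∂μ ≥
        (1 - ε) * ∫ ω, truncSumN T χ n (gSeq μ χ b n) ω ∂μ := by
  classical
  obtain ⟨r, hr, hψ⟩ := hmix
  haveI := hD.prob
  have hT := hD.invariant
  have hχ := hD.chi_meas
  have h0 := hD.chi_nonneg
  set p : ℝ → ℝ := fun x => μ.real {ω | x < χ ω} with hpdef
  have htail' : ∀ x : ℝ, 0 < x → p x = L x / x ^ α := htail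
  have hp : ∀ x, 0 < x → 0 < p x := fun x hx => by
    rw [htail' x hx]
    exact div_pos (hLpos x hx) (Real.rpow_pos_of_pos hx α)
  have hpanti : Antitone p := fun x y hxy =>
    measureReal_mono (fun ω (hω : y < χ ω) => lt_of_le_of_lt hxy hω)
  have hF : ∀ x, distF μ χ x = 1 - p x := by
    intro x
    have hm2 : MeasurableSet {ω | x < χ ω} := measurableSet_lt measurable_const hχ
    have := probReal_compl_eq_one_sub (μ := μ) hm2
    rw [hpdef]
    show _ = 1 - μ.real {ω | x < χ ω}
    rw [← this]
    show μ.real _ = _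
    congr 1
    ext ω; simp
  -- integrability
  have h2α : (2 : ℝ) ^ (-α) < 1 := Real.rpow_lt_one_of_one_lt_of_neg one_lt_two (by linarith)
  obtain ⟨ρ, hρ1, hρ2⟩ := exists_between h2α
  have hρ0 : 0 ≤ ρ := (Real.rpow_pos_of_pos two_pos (-α)).le.trans hρ1.le
  obtain ⟨x₁, hx₁⟩ := eventually_atTop.1
    (TrimAux.ratio_le p L hL α htail' hp 2 two_pos ρ hρ1)
  obtain ⟨j, hj⟩ := exists_pow_lt_of_lt_one (by norm_num : (0:ℝ) < 1 / 2) hρ2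
  have hint : ∀ n, r * j ≤ b n → 1 ≤ n → Integrable (trimmedSumN T χ n (b n)) μ := fun n hbn hn =>
    TrimAux.trimmed_integrable T χ μ hT hχ h0 r hr hψ (max x₁ 1) ρ (by positivity) hρ0
      (fun x hx => hx₁ x ((le_max_left _ _).trans hx)) j n (b n) hj hbn hn
  -- tail of `p`
  have hp0 : Tendsto p atTop (𝓝 0) := by
    haveI : IsProbabilityMeasure (μ.map χ) := Measure.isProbabilityMeasure_map hχ.aemeasurable
    have h1 := ProbabilityTheory.tendsto_cdf_atTop (μ.map χ)
    have h2 : ∀ x, ProbabilityTheory.cdf (μ.map χ) x = 1 - p x := by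
      intro x
      rw [ProbabilityTheory.cdf_eq_real, map_measureReal_apply hχ measurableSet_Iic, ← hF x]
      rfl
    have h3 : Tendsto (fun x => 1 - ProbabilityTheory.cdf (μ.map χ) x) atTop (𝓝 (1 - 1)) :=
      h1.const_sub 1
    simpa [h2] using h3
  intro ε hε
  have h2α' : 1 < (2 : ℝ) ^ α := Real.one_lt_rpow one_lt_two hα0
  set κ : ℝ := ((2 : ℝ) ^ α - 1) / 4 with hκ
  have hκ0 : 0 < κ := by rw [hκ]; linarith
  set s : ℝ := Real.sqrt (1 + ε * κ) with hs
  have hεκ : 0 < ε * κ := mul_pos hε hκ0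
  have hss : s * s = 1 + ε * κ := Real.mul_self_sqrt (by linarith)
  have hs1 : 1 < s := by
    rw [hs]; exact Real.lt_sqrt_of_sq_lt (by linarith)
  set c : ℝ := (Real.sqrt s) ^ (-(1 / α)) with hc
  have hss1 : 1 < Real.sqrt s := Real.lt_sqrt_of_sq_lt (by linarith)
  have hc0 : 0 < c := Real.rpow_pos_of_pos (by linarith) _
  have hc1 : c < 1 := Real.rpow_lt_one_of_one_lt_of_neg hss1
    (by have : 0 < 1 / α := by positivity
        linarith)
  have hcα : c ^ (-α) < s := by
    rw [hc, ← Real.rpow_mul (by linarith)]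
    have : -(1 / α) * -α = 1 := by field_simp
    rw [this, Real.rpow_one]
    nlinarith [Real.mul_self_sqrt (show 0 ≤ s by linarith)]
  have hev1 := TrimAux.ratio_le p L hL α htail' hp c hc0 s hcα
  have hhalf : (1 : ℝ) + 2 * κ < (1 / 2 : ℝ) ^ (-α) := by
    rw [one_div, Real.inv_rpow two_pos.le, Real.rpow_neg two_pos.le, inv_inv, hκ]
    linarith
  have hev2 := TrimAux.ratio_ge p L hL α htail' hp (1 / 2) (by norm_num) _ hhalf
  obtain ⟨x₂, hx₂⟩ := eventually_atTop.1 (hev1.and hev2)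
  set X := max x₂ 1 with hX
  have hX0 : 0 < X := lt_of_lt_of_le one_pos (le_max_right _ _)
  -- asymptotics of `b`
  have hbR : Tendsto (fun n => (b n : ℝ)) atTop atTop := tendsto_natCast_atTop_atTop.comp hb
  have hbneg : Tendsto (fun n => (b n : ℝ) ^ (-(1 / 3 : ℝ))) atTop (𝓝 0) :=
    (tendsto_rpow_neg_atTop (by norm_num)).comp hbR
  have hδ : 0 < 1 - 1 / s := by
    have : 1 / s < 1 := by rw [div_lt_one (by linarith)]; exact hs1
    linarith
  have key : ∀ᶠ n in atTop, 1 ≤ n ∧ r * j ≤ b n ∧ (1 : ℝ) ≤ b n ∧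
      (b n : ℝ) ^ (-(1 / 3 : ℝ)) < 1 - 1 / s ∧ (b n : ℝ) / n < p X := by
    filter_upwards [eventually_ge_atTop 1, hb.eventually_ge_atTop (r * j),
      hbR.eventually_ge_atTop 1, hbneg.eventually (gt_mem_nhds hδ),
      hbo.eventually (gt_mem_nhds (hp X hX0))] with n a1 a2 a3 a4 a5
    exact ⟨a1, a2, a3, a4, a5⟩
  obtain ⟨N, hN⟩ := eventually_atTop.1 key
  refine ⟨N, fun n hn => ?_⟩
  obtain ⟨a1, a2, a3, a4, a5⟩ := hN n hn
  have hn0 : (0 : ℝ) < n := by exact_mod_cast a1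
  have hB0 : (0 : ℝ) < b n := by linarith
  set ζ : ℝ := (b n : ℝ) ^ ((2 : ℝ) / 3) with hζ
  have hζ1 : ζ = b n * (b n : ℝ) ^ (-(1 / 3 : ℝ)) := by
    rw [hζ]
    nth_rewrite 2 [← Real.rpow_one (b n : ℝ)]
    rw [← Real.rpow_add hB0]
    norm_num
  have hζ0 : 0 < ζ := Real.rpow_pos_of_pos hB0 _
  have hζ2 : (b n : ℝ) / s ≤ b n - ζ := by
    rw [hζ1]
    have := mul_le_mul_of_nonneg_left a4.le hB0.le
    have e : (b n : ℝ) * (1 - 1 / s) = b n - b n / s := by ring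
    linarith
  have hbs : 0 < (b n : ℝ) / s := div_pos hB0 (by linarith)
  set u : ℝ := ((b n : ℝ) - ζ) / n with hu
  have hu0 : 0 < u := div_pos (by linarith) hn0
  have hu1 : u < p X := lt_of_le_of_lt (by rw [hu]; gcongr; linarith) a5
  set g := gSeq μ χ b n with hgdef
  have hgeq : g = sInf {x : ℝ | 1 - u ≤ distF μ χ x} := rfl
  have hlb : ∀ x ∈ {x : ℝ | 1 - u ≤ distF μ χ x}, X ≤ x := by
    intro x hx
    have hx' : 1 - u ≤ distF μ χ x := hx
    rw [hF] at hx'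
    by_contra hlt
    have := hpanti (not_le.1 hlt).le
    linarith
  have hne : {x : ℝ | 1 - u ≤ distF μ χ x}.Nonempty := by
    obtain ⟨x, hx⟩ := (hp0.eventually (gt_mem_nhds hu0)).exists
    refine ⟨x, ?_⟩
    show 1 - u ≤ distF μ χ x
    rw [hF]; linarith
  have hXg : X ≤ g := by rw [hgeq]; exact le_csInf hne hlb
  have hg0 : 0 < g := hX0.trans_le hXg
  have hpc : u ≤ p (c * g) := by
    by_contra hcon
    have hmem : c * g ∈ {x : ℝ | 1 - u ≤ distF μ χ x} := by
      show 1 - u ≤ distF μ χ (c * g)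
      rw [hF]; linarith
    have : g ≤ c * g := by
      conv_lhs => rw [hgeq]
      exact csInf_le ⟨X, hlb⟩ hmem
    nlinarith
  obtain ⟨e1, e2⟩ := hx₂ g ((le_max_left _ _).trans hXg)
  have hpg := hp g hg0
  have hnp : (b n : ℝ) ≤ n * p g * (1 + ε * κ) := by
    have f1 : u ≤ s * p g := hpc.trans e1
    rw [hu, div_le_iff₀ hn0] at f1
    have f2 : (b n : ℝ) / s ≤ s * p g * n := hζ2.trans f1
    rw [div_le_iff₀ (by linarith)] at f2
    rw [← hss]
    linarith
  have hA := TrimAux.trunc_lower χ μ hχ h0 g hg0.le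
  obtain ⟨hE1, hE2⟩ := TrimAux.expect_lower T χ μ hT hχ h0 n (b n) g hg0.le (hint n a2 a1)
  set A := ∫ ω, (if χ ω ≤ g then χ ω else 0) ∂μ with hAdef
  have hA2 : κ * g * p g ≤ A := by
    have e2' : (1 + 2 * κ) * p g ≤ p (g / 2) := by
      rwa [one_div_mul_eq_div] at e2
    have : g / 2 * (2 * κ * p g) ≤ g / 2 * (p (g / 2) - p g) := by
      gcongr; linarith
    calc κ * g * p g = g / 2 * (2 * κ * p g) := by ring
      _ ≤ _ := this
      _ ≤ A := hA
  rw [hE1]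
  have hfin : (b n : ℝ) * g ≤ n * (g * p g) + ε * (n * A) := by
    calc (b n : ℝ) * g ≤ n * p g * (1 + ε * κ) * g := by gcongr
      _ = n * (g * p g) + ε * (n * (κ * g * p g)) := by ring
      _ ≤ _ := by gcongr
  have hE3 : n * A + n * (g * p g) - b n * g ≤ ∫ ω, trimmedSumN T χ n (b n) ω ∂μ := hE2
  linarith
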